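/- For the Cartesian product C_m □ P_n of a cycle C_m (m ≥ 3) and a path P_n (n ≥ 2): if 2n > m then Mcut(C_m □ P_n) = 2(2n − 1)/(16⌊n/2⌋⌈n/2⌉ − 4n + 1), and if 2n ≤ m then Mcut(C_m □ P_n) = nm/((2n − 1)⌊m/2⌋⌈m/2⌉). -/

import Mathlib

open Finset

/-- The degree of vertex `i` in a weighted graph with weight matrix `W`. -/
noncomputable def wdeg {V : Type} [Fintype V] (W : Matrix V V ℝ) (i : V) : ℝ := ∑ j, W i j

/-- `vol(A) = ∑_{i ∈ A} d_i`. -/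
noncomputable def wvol {V : Type} [Fintype V] (W : Matrix V V ℝ) (A : Finset V) : ℝ :=
  ∑ i ∈ A, wdeg W i

/-- `cut(A, V∖A) = ∑_{i ∈ A, j ∉ A} w_{ij}`. -/
noncomputable def wcut {V : Type} [Fintype V] [DecidableEq V] (W : Matrix V V ℝ)
    (A : Finset V) : ℝ :=
  ∑ i ∈ A, ∑ j ∈ Aᶜ, W i j

/-- The normalized cut `Ncut(A, V∖A) = cut(A,V∖A)·(1/vol(A) + 1/vol(V∖A))`. -/
noncomputable def wncut {V : Type} [Fintype V] [DecidableEq V] (W : Matrix V V ℝ)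
    (A : Finset V) : ℝ :=
  wcut W A * (1 / wvol W A + 1 / wvol W Aᶜ)

/-- The minimum normalized cut `Mcut(G)`: the minimum of `Ncut(A, V∖A)` over all
nonempty proper subsets `A` of the vertex set. -/
noncomputable def wmcut {V : Type} [Fintype V] [DecidableEq V] (W : Matrix V V ℝ) : ℝ :=
  sInf {x : ℝ | ∃ A : Finset V, A.Nonempty ∧ Aᶜ.Nonempty ∧ x = wncut W A}

/-- The weight (adjacency) matrix of the Cartesian product `C_m □ P_n` of the cycle
`C_m` and the path `P_n`: `(i,j)` and `(i',j')` are adjacent iff `i = i'` and `j,j'`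
are consecutive in the path, or `j = j'` and `i,i'` are adjacent on the cycle. -/
noncomputable def cycleBoxPathW (m n : ℕ) :
    Matrix (Fin m × Fin n) (Fin m × Fin n) ℝ :=
  Matrix.of fun p q =>
    if (p.1 = q.1 ∧ (p.2.val + 1 = q.2.val ∨ q.2.val + 1 = p.2.val))
        ∨ (p.2 = q.2 ∧ p.1 ≠ q.1 ∧
            ((p.1.val + 1) % m = q.1.val ∨ (q.1.val + 1) % m = p.1.val)) then 1 else 0


/-! ### Generic facts about weighted cuts -/

section Generic

variable {V : Type} [Fintype V] [DecidableEq V]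

lemma wcut_eq_sum_ite (W : Matrix V V ℝ) (A : Finset V) :
    wcut W A = ∑ p, ∑ q, if p ∈ A ∧ q ∉ A then W p q else 0 := by
  unfold wcut
  rw [← Finset.sum_filter_add_sum_filter_not univ (fun p => p ∈ A)]
  rw [Finset.sum_eq_zero (s := univ.filter (fun p => p ∉ A)), add_zero]
  · refine Finset.sum_congr (by ext; simp) fun p hp => ?_
    rw [← Finset.sum_filter]
    have hp' : p ∈ A := by simpa using hp
    refine Finset.sum_congr (by ext; simp [hp']) fun _ _ => rfl
  · intro p hp
    simp at hp
    simp [hp]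

lemma wcut_nonneg {W : Matrix V V ℝ} (hW : ∀ p q, 0 ≤ W p q) (A : Finset V) :
    0 ≤ wcut W A :=
  Finset.sum_nonneg fun _ _ => Finset.sum_nonneg fun _ _ => hW _ _

lemma wcut_compl {W : Matrix V V ℝ} (hW : ∀ p q, W p q = W q p) (A : Finset V) :
    wcut W Aᶜ = wcut W A := by
  unfold wcut
  rw [compl_compl]
  refine Finset.sum_comm.trans ?_
  exact Finset.sum_congr rfl fun _ _ => Finset.sum_congr rfl fun _ _ => hW _ _

lemma wcut_eq_sum_product (W : Matrix V V ℝ) (A : Finset V) :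
    wcut W A = ∑ e ∈ A ×ˢ Aᶜ, W e.1 e.2 := by
  rw [Finset.sum_product]; rfl

lemma one_le_wcut {W : Matrix V V ℝ} (hW : ∀ p q, 0 ≤ W p q) {A : Finset V} {p q : V}
    (hp : p ∈ A) (hq : q ∉ A) (h : W p q = 1) : 1 ≤ wcut W A := by
  rw [wcut_eq_sum_product, ← h]
  exact Finset.single_le_sum (f := fun e : V × V => W e.1 e.2) (fun e _ => hW e.1 e.2)
    (by simp [hp, hq] : (p, q) ∈ A ×ˢ Aᶜ)

lemma two_le_wcut {W : Matrix V V ℝ} (hW : ∀ p q, 0 ≤ W p q) {A : Finset V} {p q p' q' : V}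
    (hp : p ∈ A) (hq : q ∉ A) (h : W p q = 1) (hp' : p' ∈ A) (hq' : q' ∉ A) (h' : W p' q' = 1)
    (hne : (p, q) ≠ (p', q')) : 2 ≤ wcut W A := by
  rw [wcut_eq_sum_product]
  calc (2 : ℝ) = ∑ e ∈ {(p, q), (p', q')}, W e.1 e.2 := by
        rw [Finset.sum_pair hne, h, h']; norm_num
    _ ≤ _ := by
        refine Finset.sum_le_sum_of_subset_of_nonneg ?_ fun e _ _ => hW _ _
        intro e he
        simp only [mem_insert, mem_singleton] at he
        rcases he with rfl | rfl <;> simp [*]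

lemma wvol_add_wvol_compl (W : Matrix V V ℝ) (A : Finset V) :
    wvol W A + wvol W Aᶜ = wvol W univ :=
  Finset.sum_add_sum_compl A _

end Generic

lemma Nat.exists_step {p : ℕ → Prop} {a b : ℕ} (hab : a ≤ b) (ha : p a) (hb : ¬ p b) :
    ∃ t, a ≤ t ∧ t < b ∧ p t ∧ ¬ p (t + 1) := by
  by_contra! h
  have : ∀ k, a ≤ k → k ≤ b → p k := by
    intro k hk
    induction k, hk using Nat.le_induction with
    | base => exact fun _ => ha
    | succ k hk ih => exact fun hkb => h k hk (by omega) (ih (by omega))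
  exact hb (this b hab le_rfl)

/-! ### The two factors -/

/-- Adjacency matrix of the path `P_n`. -/
noncomputable def pathW (n : ℕ) : Matrix (Fin n) (Fin n) ℝ :=
  Matrix.of fun a b => if a.val + 1 = b.val ∨ b.val + 1 = a.val then 1 else 0

/-- Adjacency matrix of the cycle `C_m`. -/
noncomputable def cycleW (m : ℕ) : Matrix (Fin m) (Fin m) ℝ :=
  Matrix.of fun a b =>
    if a ≠ b ∧ ((a.val + 1) % m = b.val ∨ (b.val + 1) % m = a.val) then 1 else 0

lemma pathW_nonneg {n : ℕ} (a b : Fin n) : 0 ≤ pathW n a b := by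
  simp only [pathW, Matrix.of_apply]; split_ifs <;> norm_num

lemma cycleW_nonneg {m : ℕ} (a b : Fin m) : 0 ≤ cycleW m a b := by
  simp only [cycleW, Matrix.of_apply]; split_ifs <;> norm_num

lemma pathW_symm {n : ℕ} (a b : Fin n) : pathW n a b = pathW n b a := by
  simp only [pathW, Matrix.of_apply, or_comm]

lemma cycleW_symm {m : ℕ} (a b : Fin m) : cycleW m a b = cycleW m b a := by
  simp only [cycleW, Matrix.of_apply, or_comm, ne_comm]

lemma exists_path_step {n : ℕ} {S : Finset (Fin n)} {a b : Fin n} (hab : a ≤ b) (ha : a ∈ S)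
    (hb : b ∉ S) : ∃ s t : Fin n, a ≤ s ∧ t ≤ b ∧ s.val + 1 = t.val ∧ s ∈ S ∧ t ∉ S := by
  obtain ⟨t, h1, h2, h3, h4⟩ := Nat.exists_step (p := fun k => ∃ h : k < n, (⟨k, h⟩ : Fin n) ∈ S)
    (a := a) (b := b) hab ⟨a.2, ha⟩ (by rintro ⟨_, h⟩; exact hb h)
  obtain ⟨ht, h3⟩ := h3
  exact ⟨⟨t, ht⟩, ⟨t + 1, by omega⟩, h1, by simp only [Fin.le_def]; omega, rfl, h3,
    fun h => h4 ⟨_, h⟩⟩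

lemma one_le_wcut_pathW {n : ℕ} {S : Finset (Fin n)} (h : S.Nonempty) (h' : Sᶜ.Nonempty) :
    1 ≤ wcut (pathW n) S := by
  obtain ⟨a, ha⟩ := h
  obtain ⟨b, hb⟩ := h'
  rcases le_total a b with hab | hab
  · obtain ⟨s, t, -, -, hst, hs, ht⟩ := exists_path_step hab ha (by simpa using hb)
    exact one_le_wcut pathW_nonneg hs ht (by simp [pathW, hst])
  · obtain ⟨s, t, -, -, hst, hs, ht⟩ := exists_path_step (S := Sᶜ) hab hb (by simpa using ha)
    exact one_le_wcut pathW_nonneg (p := t) (q := s) (by simpa using ht) (by simpa using hs)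
      (by simp [pathW, hst])

lemma two_le_wcut_pathW_of_mem {n : ℕ} {S : Finset (Fin n)} {a b c : Fin n} (hab : a ≤ b)
    (hbc : b ≤ c) (ha : a ∈ S) (hb : b ∉ S) (hc : c ∈ S) : 2 ≤ wcut (pathW n) S := by
  obtain ⟨s, t, -, h2, hst, hs, ht⟩ := exists_path_step hab ha hb
  obtain ⟨s', t', h1', -, hst', hs', ht'⟩ :=
    exists_path_step (S := Sᶜ) hbc (by simpa using hb) (by simpa using hc)
  refine two_le_wcut pathW_nonneg (p := s) (q := t) (p' := t') (q' := s') hs ht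
    (by simp [pathW, hst]) (by simpa using ht') (by simpa using hs') (by simp [pathW, hst']) ?_
  intro h
  simp only [Prod.mk.injEq, Fin.ext_iff] at h
  omega

lemma exists_cycle_step {m : ℕ} {S : Finset (Fin m)} (h : S.Nonempty) (h' : Sᶜ.Nonempty) :
    ∃ s t : Fin m, (s.val + 1) % m = t.val ∧ s ∈ S ∧ t ∉ S := by
  obtain ⟨a, ha⟩ := h
  obtain ⟨b, hb⟩ := h'
  have hm : 0 < m := a.pos
  obtain ⟨t, -, -, h3, h4⟩ := Nat.exists_step
    (p := fun k => (⟨(a.val + k) % m, Nat.mod_lt _ hm⟩ : Fin m) ∈ S)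
    (a := 0) (b := m - a + b) (Nat.zero_le _)
    (by simpa [Nat.mod_eq_of_lt a.2] using ha)
    (by
      have : a.val + (m - a + b) = b + m := by omega
      simpa [this, Nat.mod_eq_of_lt b.2] using hb)
  exact ⟨_, _, by simp only [Nat.mod_add_mod, Nat.add_assoc], h3, h4⟩

lemma succ_mod_eq {m a : ℕ} (ha : a < m) : (a + 1) % m = if a + 1 = m then 0 else a + 1 := by
  split_ifs with h
  · simp [h]
  · exact Nat.mod_eq_of_lt (by omega)

lemma two_le_wcut_cycleW {m : ℕ} (hm : 3 ≤ m) {S : Finset (Fin m)} (h : S.Nonempty)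
    (h' : Sᶜ.Nonempty) : 2 ≤ wcut (cycleW m) S := by
  obtain ⟨s, t, hst, hs, ht⟩ := exists_cycle_step h h'
  obtain ⟨s', t', hst', hs', ht'⟩ := exists_cycle_step (S := Sᶜ) h' (by simpa using h)
  have hs'' : s' ∉ S := by simpa using hs'
  have ht'' : t' ∈ S := by simpa using ht'
  refine two_le_wcut cycleW_nonneg (p := s) (q := t) (p' := t') (q' := s') hs ht
    ?_ ht'' hs'' ?_ ?_
  · have : s ≠ t := fun h => ht (h ▸ hs)
    simp [cycleW, hst, this]
  · have : t' ≠ s' := fun h => hs'' (h ▸ ht'')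
    simp [cycleW, hst', this]
  · intro h
    simp only [Prod.mk.injEq, Fin.ext_iff] at h
    rw [succ_mod_eq s.2] at hst
    rw [succ_mod_eq s'.2] at hst'
    split_ifs at hst hst' <;> omega

lemma wdeg_pathW {n : ℕ} (hn : 2 ≤ n) (j : Fin n) :
    wdeg (pathW n) j = 2 - (if j.val = 0 then 1 else 0) - (if j.val = n - 1 then 1 else 0) := by
  have h : ∀ k : Fin n, pathW n j k =
      (if j.val + 1 = k.val then 1 else 0) + (if k.val + 1 = j.val then 1 else 0) := by
    intro k
    simp only [pathW, Matrix.of_apply]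
    split_ifs <;> first | omega | norm_num
  have h1 : (∑ k : Fin n, if j.val + 1 = k.val then (1 : ℝ) else 0) =
      1 - if j.val = n - 1 then 1 else 0 := by
    split_ifs with hj
    · rw [Finset.sum_eq_zero]
      · norm_num
      · intro k _
        rw [if_neg (by omega)]
    · rw [Finset.sum_eq_single ⟨j.val + 1, by omega⟩]
      · simp
      · intro k _ hk
        rw [if_neg fun h => hk (Fin.ext h.symm)]
      · simp
  have h2 : (∑ k : Fin n, if k.val + 1 = j.val then (1 : ℝ) else 0) =
      1 - if j.val = 0 then 1 else 0 := by
    split_ifs with hj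
    · rw [Finset.sum_eq_zero]
      · norm_num
      · intro k _
        rw [if_neg (by omega)]
    · rw [Finset.sum_eq_single ⟨j.val - 1, by omega⟩]
      · rw [if_pos (by simp only; omega)]; norm_num
      · intro k _ hk
        rw [if_neg fun h => hk (Fin.ext (by simp only; omega))]
      · simp
  simp only [wdeg, h, Finset.sum_add_distrib, h1, h2]
  ring

lemma wdeg_cycleW {m : ℕ} (hm : 3 ≤ m) (i : Fin m) : wdeg (cycleW m) i = 2 := by
  set s : Fin m := ⟨(i.val + 1) % m, Nat.mod_lt _ (by omega)⟩ with hs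
  set t : Fin m := ⟨if i.val = 0 then m - 1 else i.val - 1, by split_ifs <;> omega⟩ with ht
  have hsv : s.val = if i.val + 1 = m then 0 else i.val + 1 := succ_mod_eq i.2
  have htv : t.val = if i.val = 0 then m - 1 else i.val - 1 := rfl
  have hne : s ≠ t := by
    intro h
    rw [Fin.ext_iff, hsv, htv] at h
    split_ifs at h <;> omega
  have h : ∀ k : Fin m, cycleW m i k = if k ∈ ({s, t} : Finset (Fin m)) then 1 else 0 := by
    intro k
    simp only [cycleW, Matrix.of_apply, mem_insert, mem_singleton]
    refine if_congr ?_ rfl rfl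
    rw [succ_mod_eq i.2, succ_mod_eq k.2]
    simp only [Fin.ext_iff, hsv, htv, ne_eq]
    have := k.2
    have := i.2
    split_ifs <;> omega
  simp only [wdeg, h]
  rw [Finset.sum_ite_mem, univ_inter, Finset.sum_pair hne]
  norm_num

/-! ### Sections of a vertex set of the product -/

section Product

variable {m n : ℕ}

/-- The part of `A` in the copy of the path over `i`. -/
def pathSection (A : Finset (Fin m × Fin n)) (i : Fin m) : Finset (Fin n) :=
  univ.filter fun j => (i, j) ∈ A

/-- The part of `A` in the copy of the cycle over `j`. -/
def cycleSection (A : Finset (Fin m × Fin n)) (j : Fin n) : Finset (Fin m) :=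
  univ.filter fun i => (i, j) ∈ A

@[simp] lemma mem_pathSection {A : Finset (Fin m × Fin n)} {i : Fin m} {j : Fin n} :
    j ∈ pathSection A i ↔ (i, j) ∈ A := by simp [pathSection]

@[simp] lemma mem_cycleSection {A : Finset (Fin m × Fin n)} {i : Fin m} {j : Fin n} :
    i ∈ cycleSection A j ↔ (i, j) ∈ A := by simp [cycleSection]

lemma cycleBoxPathW_apply (p q : Fin m × Fin n) : cycleBoxPathW m n p q =
    (if p.1 = q.1 then pathW n p.2 q.2 else 0) + (if p.2 = q.2 then cycleW m p.1 q.1 else 0) := by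
  simp only [cycleBoxPathW, pathW, cycleW, Matrix.of_apply]
  by_cases h1 : p.1 = q.1 <;> by_cases h2 : p.2 = q.2 <;> simp [h1, h2]

lemma cycleBoxPathW_symm (p q : Fin m × Fin n) :
    cycleBoxPathW m n p q = cycleBoxPathW m n q p := by
  simp only [cycleBoxPathW_apply, pathW_symm p.2, cycleW_symm p.1, eq_comm]

lemma wcut_cycleBoxPathW (A : Finset (Fin m × Fin n)) :
    wcut (cycleBoxPathW m n) A =
      ∑ i, wcut (pathW n) (pathSection A i) + ∑ j, wcut (cycleW m) (cycleSection A j) := by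
  have h1 : ∀ p : Fin m × Fin n, (∑ q : Fin m × Fin n, if p ∈ A ∧ q ∉ A then
      (if p.1 = q.1 then pathW n p.2 q.2 else 0) else 0) =
      ∑ k, if p ∈ A ∧ (p.1, k) ∉ A then pathW n p.2 k else 0 := by
    intro p
    rw [Fintype.sum_prod_type, Finset.sum_eq_single p.1]
    · simp
    · intro i _ hi
      simp [hi.symm]
    · simp
  have h2 : ∀ p : Fin m × Fin n, (∑ q : Fin m × Fin n, if p ∈ A ∧ q ∉ A then
      (if p.2 = q.2 then cycleW m p.1 q.1 else 0) else 0) =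
      ∑ k, if p ∈ A ∧ (k, p.2) ∉ A then cycleW m p.1 k else 0 := by
    intro p
    rw [Fintype.sum_prod_type_right, Finset.sum_eq_single p.2]
    · simp
    · intro i _ hi
      simp [hi.symm]
    · simp
  simp only [wcut_eq_sum_ite, mem_pathSection, mem_cycleSection, cycleBoxPathW_apply]
  have h3 : ∀ (P : Prop) [Decidable P] (a b : ℝ), (if P then a + b else 0) =
      (if P then a else 0) + (if P then b else 0) := by
    intro P _ a b; split_ifs <;> simp
  simp only [h3, Finset.sum_add_distrib, h1, h2]
  rw [Fintype.sum_prod_type, Fintype.sum_prod_type_right]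

lemma wdeg_cycleBoxPathW (hm : 3 ≤ m) (p : Fin m × Fin n) :
    wdeg (cycleBoxPathW m n) p = 2 + wdeg (pathW n) p.2 := by
  rw [← wdeg_cycleW hm p.1]
  simp only [wdeg, cycleBoxPathW_apply, Finset.sum_add_distrib]
  rw [add_comm]
  congr 1
  · rw [Fintype.sum_prod_type_right, Finset.sum_eq_single p.2]
    · simp
    · intro i _ hi
      simp [hi.symm]
    · simp
  · rw [Fintype.sum_prod_type, Finset.sum_eq_single p.1]
    · simp
    · intro i _ hi
      simp [hi.symm]
    · simp

lemma wdeg_pathW_bounds (hn : 2 ≤ n) (j : Fin n) :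
    1 ≤ wdeg (pathW n) j ∧ wdeg (pathW n) j ≤ 2 := by
  rw [wdeg_pathW hn]
  split_ifs <;> first | omega | norm_num

lemma wvol_cycleBoxPathW_le (hm : 3 ≤ m) (hn : 2 ≤ n) (A : Finset (Fin m × Fin n)) :
    wvol (cycleBoxPathW m n) A ≤ 4 * #A := by
  unfold wvol
  calc _ ≤ ∑ _p ∈ A, (4 : ℝ) := Finset.sum_le_sum fun p _ => by
        rw [wdeg_cycleBoxPathW hm]; linarith [(wdeg_pathW_bounds hn p.2).2]
    _ = _ := by simp [mul_comm]

lemma wvol_cycleBoxPathW_pos (hm : 3 ≤ m) (hn : 2 ≤ n) {A : Finset (Fin m × Fin n)}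
    (hA : A.Nonempty) : 0 < wvol (cycleBoxPathW m n) A :=
  Finset.sum_pos (fun p _ => by
    rw [wdeg_cycleBoxPathW hm]; linarith [(wdeg_pathW_bounds hn p.2).1]) hA

lemma sum_two_add_wdeg_pathW (hn : 2 ≤ n) (S : Finset (Fin n)) :
    ∑ j ∈ S, (2 + wdeg (pathW n) j) = 4 * #S -
      (if (⟨0, by omega⟩ : Fin n) ∈ S then 1 else 0) -
      (if (⟨n - 1, by omega⟩ : Fin n) ∈ S then 1 else 0) := by
  have h : ∀ j : Fin n, 2 + wdeg (pathW n) j = 4 - (if j = ⟨0, by omega⟩ then 1 else 0) -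
      (if j = ⟨n - 1, by omega⟩ then 1 else 0) := by
    intro j
    rw [wdeg_pathW hn]
    simp only [Fin.ext_iff]
    ring
  simp only [h, Finset.sum_sub_distrib, Finset.sum_ite_eq', Finset.sum_const, nsmul_eq_mul]
  ring

lemma wvol_univ_product (hm : 3 ≤ m) (S : Finset (Fin n)) :
    wvol (cycleBoxPathW m n) (univ ×ˢ S) = m * ∑ j ∈ S, (2 + wdeg (pathW n) j) := by
  simp only [wvol, wdeg_cycleBoxPathW hm, Finset.sum_product]
  simp

lemma wvol_product_univ (hm : 3 ≤ m) (hn : 2 ≤ n) (T : Finset (Fin m)) :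
    wvol (cycleBoxPathW m n) (T ×ˢ univ) = #T * (4 * n - 2) := by
  simp only [wvol, wdeg_cycleBoxPathW hm, Finset.sum_product]
  rw [sum_two_add_wdeg_pathW hn]
  simp
  ring

lemma wvol_univ (hm : 3 ≤ m) (hn : 2 ≤ n) :
    wvol (cycleBoxPathW m n) univ = 2 * m * (2 * n - 1) := by
  rw [← univ_product_univ, wvol_product_univ hm hn]
  simp
  ring

lemma wcut_cycleBoxPathW_eq_natCast (A : Finset (Fin m × Fin n)) :
    ∃ c : ℕ, wcut (cycleBoxPathW m n) A = c := by
  refine ⟨∑ p ∈ A, ∑ q ∈ Aᶜ, if (p.1 = q.1 ∧ (p.2.val + 1 = q.2.val ∨ q.2.val + 1 = p.2.val))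
        ∨ (p.2 = q.2 ∧ p.1 ≠ q.1 ∧
            ((p.1.val + 1) % m = q.1.val ∨ (q.1.val + 1) % m = p.1.val)) then 1 else 0, ?_⟩
  push_cast
  rfl

lemma wncut_eq {V : Type} [Fintype V] [DecidableEq V] {W : Matrix V V ℝ} {A : Finset V}
    (h : 0 < wvol W A) (h' : 0 < wvol W Aᶜ) :
    wncut W A = wcut W A * wvol W univ / (wvol W A * wvol W Aᶜ) := by
  rw [← wvol_add_wvol_compl W A, wncut]
  field_simp
  ring

lemma pathSection_compl (A : Finset (Fin m × Fin n)) (i : Fin m) :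
    pathSection Aᶜ i = (pathSection A i)ᶜ := by ext; simp

lemma cycleSection_compl (A : Finset (Fin m × Fin n)) (j : Fin n) :
    cycleSection Aᶜ j = (cycleSection A j)ᶜ := by ext; simp

lemma two_mul_wvol_le_sq_wcut (hm : 3 ≤ m) (hn : 2 ≤ n) {A : Finset (Fin m × Fin n)} {i₀ : Fin m}
    {j₀ : Fin n} (hi : pathSection A i₀ = ∅) (hj : cycleSection A j₀ = ∅) :
    2 * wvol (cycleBoxPathW m n) A ≤ wcut (cycleBoxPathW m n) A ^ 2 := by
  set I := univ.filter fun i => (pathSection A i).Nonempty with hI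
  set J := univ.filter fun j => (cycleSection A j).Nonempty with hJ
  have hcard : (#A : ℝ) ≤ #I * #J := by
    rw [← Nat.cast_mul, ← card_product]
    refine Nat.cast_le.2 (card_le_card fun p hp => ?_)
    rw [mem_product, hI, hJ]
    simp only [mem_filter, mem_univ, true_and]
    exact ⟨⟨p.2, by simpa⟩, ⟨p.1, by simpa⟩⟩
  have hI' : (#I : ℝ) ≤ ∑ i, wcut (pathW n) (pathSection A i) := by
    rw [hI, Finset.card_filter]
    push_cast
    refine Finset.sum_le_sum fun i _ => ?_
    split_ifs with h
    · refine one_le_wcut_pathW h ⟨j₀, ?_⟩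
      have : i ∉ cycleSection A j₀ := by simp [hj]
      simpa using this
    · exact wcut_nonneg pathW_nonneg _
  have hJ' : 2 * (#J : ℝ) ≤ ∑ j, wcut (cycleW m) (cycleSection A j) := by
    rw [hJ, Finset.card_filter]
    push_cast
    rw [Finset.mul_sum]
    refine Finset.sum_le_sum fun j _ => ?_
    split_ifs with h
    · rw [mul_one]
      refine two_le_wcut_cycleW hm h ⟨i₀, ?_⟩
      have : j ∉ pathSection A i₀ := by simp [hi]
      simpa using this
    · rw [mul_zero]
      exact wcut_nonneg cycleW_nonneg _
  have hc : (#I : ℝ) + 2 * #J ≤ wcut (cycleBoxPathW m n) A := by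
    rw [wcut_cycleBoxPathW]; linarith
  have hv := wvol_cycleBoxPathW_le hm hn A
  have h0 : (0 : ℝ) ≤ #I + 2 * #J := by positivity
  nlinarith [sq_nonneg ((#I : ℝ) - 2 * #J)]

/-- If some path copy and some cycle copy are not separated, the cut is bounded below
isoperimetrically. -/
lemma two_mul_wvol_le_sq_wcut_or (hm : 3 ≤ m) (hn : 2 ≤ n) {A : Finset (Fin m × Fin n)}
    {i₀ : Fin m} {j₀ : Fin n}
    (hi : ¬ ((pathSection A i₀).Nonempty ∧ (pathSection A i₀)ᶜ.Nonempty))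
    (hj : ¬ ((cycleSection A j₀).Nonempty ∧ (cycleSection A j₀)ᶜ.Nonempty)) :
    2 * wvol (cycleBoxPathW m n) A ≤ wcut (cycleBoxPathW m n) A ^ 2 ∨
    2 * wvol (cycleBoxPathW m n) Aᶜ ≤ wcut (cycleBoxPathW m n) A ^ 2 := by
  by_cases h : (i₀, j₀) ∈ A
  · right
    rw [← wcut_compl cycleBoxPathW_symm]
    refine two_mul_wvol_le_sq_wcut hm hn (i₀ := i₀) (j₀ := j₀) ?_ ?_
    · rw [pathSection_compl, ← not_nonempty_iff_eq_empty]
      exact fun h' => hi ⟨⟨j₀, by simpa⟩, h'⟩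
    · rw [cycleSection_compl, ← not_nonempty_iff_eq_empty]
      exact fun h' => hj ⟨⟨i₀, by simpa⟩, h'⟩
  · left
    refine two_mul_wvol_le_sq_wcut hm hn (i₀ := i₀) (j₀ := j₀) ?_ ?_
    · rw [← not_nonempty_iff_eq_empty]
      exact fun h' => hi ⟨h', ⟨j₀, by simpa⟩⟩
    · rw [← not_nonempty_iff_eq_empty]
      exact fun h' => hj ⟨h', ⟨i₀, by simpa⟩⟩

lemma sum_wcut_pathW_ge {A : Finset (Fin m × Fin n)}
    (h : ∀ i, (pathSection A i).Nonempty ∧ (pathSection A i)ᶜ.Nonempty) :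
    (m : ℝ) ≤ ∑ i, wcut (pathW n) (pathSection A i) := by
  calc (m : ℝ) = ∑ _i : Fin m, 1 := by simp
    _ ≤ _ := Finset.sum_le_sum fun i _ => one_le_wcut_pathW (h i).1 (h i).2

lemma sum_wcut_cycleW_ge (hm : 3 ≤ m) {A : Finset (Fin m × Fin n)}
    (h : ∀ j, (cycleSection A j).Nonempty ∧ (cycleSection A j)ᶜ.Nonempty) :
    2 * (n : ℝ) ≤ ∑ j, wcut (cycleW m) (cycleSection A j) := by
  calc 2 * (n : ℝ) = ∑ _j : Fin n, 2 := by simp [mul_comm]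
    _ ≤ _ := Finset.sum_le_sum fun j _ => two_le_wcut_cycleW hm (h j).1 (h j).2

lemma sum_wcut_pathW_nonneg (A : Finset (Fin m × Fin n)) :
    0 ≤ ∑ i, wcut (pathW n) (pathSection A i) :=
  Finset.sum_nonneg fun _ _ => wcut_nonneg pathW_nonneg _

lemma sum_wcut_cycleW_nonneg (A : Finset (Fin m × Fin n)) :
    0 ≤ ∑ j, wcut (cycleW m) (cycleSection A j) :=
  Finset.sum_nonneg fun _ _ => wcut_nonneg cycleW_nonneg _

end Product

lemma wcut_empty {V : Type} [Fintype V] [DecidableEq V] (W : Matrix V V ℝ) :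
    wcut W ∅ = 0 := by simp [wcut]

lemma wcut_univ {V : Type} [Fintype V] [DecidableEq V] (W : Matrix V V ℝ) :
    wcut W univ = 0 := by simp [wcut]

lemma wcut_univ_product {m n : ℕ} (S : Finset (Fin n)) :
    wcut (cycleBoxPathW m n) (univ ×ˢ S) = m * wcut (pathW n) S := by
  have h1 : ∀ i : Fin m, pathSection (univ ×ˢ S) i = S := fun i => by ext; simp
  have h2 : ∀ j : Fin n, wcut (cycleW m) (cycleSection (univ ×ˢ S) j) = 0 := fun j => by
    by_cases hj : j ∈ S
    · rw [show cycleSection (univ ×ˢ S) j = (univ : Finset (Fin m)) by ext; simp [hj], wcut_univ]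
    · rw [show cycleSection (univ ×ˢ S) j = (∅ : Finset (Fin m)) by ext; simp [hj], wcut_empty]
  simp [wcut_cycleBoxPathW, h1, h2]

lemma wcut_product_univ {m n : ℕ} (T : Finset (Fin m)) :
    wcut (cycleBoxPathW m n) (T ×ˢ univ) = n * wcut (cycleW m) T := by
  have h1 : ∀ j : Fin n, cycleSection (T ×ˢ univ) j = T := fun i => by ext; simp
  have h2 : ∀ i : Fin m, wcut (pathW n) (pathSection (T ×ˢ univ) i) = 0 := fun i => by
    by_cases hi : i ∈ T
    · rw [show pathSection (T ×ˢ univ) i = (univ : Finset (Fin n)) by ext; simp [hi], wcut_univ]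
    · rw [show pathSection (T ×ˢ univ) i = (∅ : Finset (Fin n)) by ext; simp [hi], wcut_empty]
  simp [wcut_cycleBoxPathW, h1, h2]

/-! ### Lower bounds -/

lemma isoperimetric_estimate {c x V N K : ℝ} (hc : 0 ≤ c) (hcN : c ≤ N) (hx : 2 * x ≤ c ^ 2)
    (hV : 3 * N ^ 2 ≤ 2 * V) (hK : 0 ≤ K) (hKV : 0 ≤ V ^ 2 - 2 * N * K * V + N ^ 3 * K) :
    4 * K * (x * (V - x)) ≤ c * V ^ 2 := by
  have hcN2 : c ^ 2 ≤ N ^ 2 := by nlinarith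
  have hcN3 : N * c ≤ N ^ 2 := by nlinarith
  have h1 : x * (V - x) ≤ c ^ 2 / 2 * (V - c ^ 2 / 2) := by
    nlinarith [mul_nonneg (by linarith : 0 ≤ c ^ 2 / 2 - x)
      (by nlinarith [sq_nonneg N] : 0 ≤ V - c ^ 2 / 2 - x)]
  have h2 : c * (V - c ^ 2 / 2) ≤ N * (V - N ^ 2 / 2) := by
    nlinarith [mul_nonneg (by linarith : 0 ≤ N - c)
      (by nlinarith : 0 ≤ V - (N ^ 2 + N * c + c ^ 2) / 2)]
  have h3 : 4 * K * (x * (V - x)) ≤ 4 * K * (c ^ 2 / 2 * (V - c ^ 2 / 2)) := by gcongr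
  have h4 : 2 * K * c * (c * (V - c ^ 2 / 2)) ≤ 2 * K * c * (N * (V - N ^ 2 / 2)) := by gcongr
  nlinarith [mul_nonneg hc hKV]

lemma four_mul_mul_le_of_le {c x y V K : ℝ} (hV : x + y = V) (hK : 0 ≤ K) (hKc : K ≤ c) :
    4 * K * (x * y) ≤ c * V ^ 2 := by
  have h : 4 * (x * y) ≤ V ^ 2 := by rw [← hV]; nlinarith [sq_nonneg (x - y)]
  calc 4 * K * (x * y) = K * (4 * (x * y)) := by ring
    _ ≤ K * V ^ 2 := by gcongr
    _ ≤ c * V ^ 2 := by gcongr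

lemma mul_sub_le_half_mul_half {k n : ℕ} :
    (k : ℝ) * (n - k) ≤ ((n / 2 : ℕ) : ℝ) * (((n + 1) / 2 : ℕ) : ℝ) := by
  obtain ⟨q, rfl | rfl⟩ := Nat.even_or_odd' n
  · rw [show 2 * q / 2 = q by omega, show (2 * q + 1) / 2 = q by omega]
    push_cast
    nlinarith [sq_nonneg ((k : ℝ) - q)]
  · rw [show (2 * q + 1) / 2 = q by omega, show (2 * q + 1 + 1) / 2 = q + 1 by omega]
    push_cast
    rcases Nat.lt_or_ge q k with h | h
    · have h' : (q : ℝ) + 1 ≤ k := by exact_mod_cast h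
      nlinarith
    · have h' : (k : ℝ) ≤ q := by exact_mod_cast h
      nlinarith

section LowerBound

variable {m n : ℕ}

lemma wvol_add_compl (hm : 3 ≤ m) (hn : 2 ≤ n) (A : Finset (Fin m × Fin n)) :
    wvol (cycleBoxPathW m n) A + wvol (cycleBoxPathW m n) Aᶜ = 2 * m * (2 * n - 1) := by
  rw [wvol_add_wvol_compl, wvol_univ hm hn]

/-- The isoperimetric estimate applied to whichever of `A`, `Aᶜ` it holds for. -/
lemma four_mul_wvol_mul_wvol_le (hm : 3 ≤ m) (hn : 2 ≤ n) {A : Finset (Fin m × Fin n)}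
    {i₀ : Fin m} {j₀ : Fin n} {N K : ℝ}
    (hi : ¬ ((pathSection A i₀).Nonempty ∧ (pathSection A i₀)ᶜ.Nonempty))
    (hj : ¬ ((cycleSection A j₀).Nonempty ∧ (cycleSection A j₀)ᶜ.Nonempty))
    (hcN : wcut (cycleBoxPathW m n) A ≤ N) (hV : 3 * N ^ 2 ≤ 2 * (2 * m * (2 * n - 1)))
    (hK : 0 ≤ K)
    (hKV : 0 ≤ (2 * m * (2 * n - 1) : ℝ) ^ 2 - 2 * N * K * (2 * m * (2 * n - 1)) + N ^ 3 * K) :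
    4 * K * (wvol (cycleBoxPathW m n) A * wvol (cycleBoxPathW m n) Aᶜ) ≤
      wcut (cycleBoxPathW m n) A * (2 * m * (2 * n - 1)) ^ 2 := by
  have hc : 0 ≤ wcut (cycleBoxPathW m n) A := by
    obtain ⟨c, hc⟩ := wcut_cycleBoxPathW_eq_natCast A
    rw [hc]; positivity
  have hV' := wvol_add_compl hm hn A
  rcases two_mul_wvol_le_sq_wcut_or hm hn hi hj with h | h
  · rw [eq_sub_of_add_eq' hV']
    exact isoperimetric_estimate hc hcN h hV hK hKV
  · rw [mul_comm (wvol _ A), eq_sub_of_add_eq hV']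
    exact isoperimetric_estimate hc hcN h hV hK hKV

lemma eq_univ_product {A : Finset (Fin m × Fin n)} (i₀ : Fin m)
    (h : ∀ j, ¬ ((cycleSection A j).Nonempty ∧ (cycleSection A j)ᶜ.Nonempty)) :
    A = univ ×ˢ pathSection A i₀ := by
  ext ⟨i, j⟩
  simp only [mem_product, mem_univ, true_and, mem_pathSection]
  constructor <;> intro h' <;> by_contra h''
  · exact h j ⟨⟨i, by simpa⟩, ⟨i₀, by simpa⟩⟩
  · exact h j ⟨⟨i₀, by simpa⟩, ⟨i, by simpa⟩⟩

lemma eq_product_univ {A : Finset (Fin m × Fin n)} (j₀ : Fin n)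
    (h : ∀ i, ¬ ((pathSection A i).Nonempty ∧ (pathSection A i)ᶜ.Nonempty)) :
    A = cycleSection A j₀ ×ˢ univ := by
  ext ⟨i, j⟩
  simp only [mem_product, mem_univ, and_true, mem_cycleSection]
  constructor <;> intro h' <;> by_contra h''
  · exact h i ⟨⟨j, by simpa⟩, ⟨j₀, by simpa⟩⟩
  · exact h i ⟨⟨j₀, by simpa⟩, ⟨j, by simpa⟩⟩

lemma sum_two_add_wdeg_pathW_of_wcut_lt_two (hn : 2 ≤ n) {S : Finset (Fin n)} (h : S.Nonempty)
    (h' : Sᶜ.Nonempty) (hS : wcut (pathW n) S < 2) :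
    ∑ j ∈ S, (2 + wdeg (pathW n) j) = 4 * #S - 1 := by
  obtain ⟨a, ha⟩ := h
  obtain ⟨b, hb⟩ := h'
  have hle : ∀ j : Fin n, (⟨0, by omega⟩ : Fin n) ≤ j ∧ j ≤ ⟨n - 1, by omega⟩ := fun j => by
    simp only [Fin.le_def]; omega
  rw [sum_two_add_wdeg_pathW hn]
  split_ifs with h1 h2 h2
  · exact absurd (two_le_wcut_pathW_of_mem (hle b).1 (hle b).2 h1 (by simpa using hb) h2)
      (not_le.2 hS)
  · ring
  · ring
  · rw [← wcut_compl pathW_symm] at hS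
    exact absurd (two_le_wcut_pathW_of_mem (hle a).1 (hle a).2 (by simpa) (by simpa using ha)
      (by simpa)) (not_le.2 hS)

lemma mul_sq_le_of_lt_two_mul (hm : 3 ≤ m) (hmn : m < 2 * n) :
    (m : ℝ) * (2 * n - 1) ^ 2 ≤ (m + 1) *
      (16 * ((n / 2 : ℕ) : ℝ) * (((n + 1) / 2 : ℕ) : ℝ) - 4 * n + 1) := by
  obtain ⟨q, rfl | rfl⟩ := Nat.even_or_odd' n
  · rw [show 2 * q / 2 = q by omega, show (2 * q + 1) / 2 = q by omega]
    push_cast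
    nlinarith [sq_nonneg (4 * (q : ℝ) - 1)]
  · rw [show (2 * q + 1) / 2 = q by omega, show (2 * q + 1 + 1) / 2 = q + 1 by omega]
    have hq : (1 : ℝ) ≤ q := by
      have : 1 ≤ q := by omega
      exact_mod_cast this
    have hmq : (m : ℝ) ≤ 4 * q + 1 := by
      have : m ≤ 4 * q + 1 := by omega
      exact_mod_cast this
    push_cast
    nlinarith

lemma wvol_mul_wvol_le_of_lt_two_mul (hm : 3 ≤ m) (hn : 2 ≤ n) (hmn : m < 2 * n)
    (A : Finset (Fin m × Fin n)) :
    wvol (cycleBoxPathW m n) A * wvol (cycleBoxPathW m n) Aᶜ ≤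
      wcut (cycleBoxPathW m n) A * m *
        (16 * ((n / 2 : ℕ) : ℝ) * (((n + 1) / 2 : ℕ) : ℝ) - 4 * n + 1) := by
  set D : ℝ := 16 * ((n / 2 : ℕ) : ℝ) * (((n + 1) / 2 : ℕ) : ℝ) - 4 * n + 1 with hD
  have hVA := wvol_add_compl hm hn A
  have hmR : (3 : ℝ) ≤ m := by exact_mod_cast hm
  have hmnR : (m : ℝ) + 1 ≤ 2 * n := by exact_mod_cast hmn
  obtain ⟨c, hc⟩ := wcut_cycleBoxPathW_eq_natCast A
  have key : 4 * ((m : ℝ) + 1) * (wvol (cycleBoxPathW m n) A * wvol (cycleBoxPathW m n) Aᶜ) ≤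
      wcut (cycleBoxPathW m n) A * (2 * m * (2 * n - 1)) ^ 2 →
      wvol (cycleBoxPathW m n) A * wvol (cycleBoxPathW m n) Aᶜ ≤
      wcut (cycleBoxPathW m n) A * m * D := by
    intro h
    refine le_of_mul_le_mul_left ?_ (by positivity : (0 : ℝ) < m + 1)
    have h' := mul_le_mul_of_nonneg_left (mul_sq_le_of_lt_two_mul hm hmn)
      (by positivity : (0 : ℝ) ≤ c * m)
    rw [hc] at h ⊢
    linarith
  rcases Nat.lt_or_ge m c with hcm | hcm
  · exact key (four_mul_mul_le_of_le hVA (by positivity) (by rw [hc]; exact_mod_cast hcm))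
  have hcmR : wcut (cycleBoxPathW m n) A ≤ m := by rw [hc]; exact_mod_cast hcm
  have hsum := wcut_cycleBoxPathW A
  by_cases hpath : ∀ i, (pathSection A i).Nonempty ∧ (pathSection A i)ᶜ.Nonempty
  · have hp := sum_wcut_pathW_ge hpath
    have hcyc : ∀ j, ¬ ((cycleSection A j).Nonempty ∧ (cycleSection A j)ᶜ.Nonempty) := by
      intro j hj
      have h1 := two_le_wcut_cycleW hm hj.1 hj.2
      have h2 := Finset.single_le_sum (f := fun j => wcut (cycleW m) (cycleSection A j))
        (fun j _ => wcut_nonneg cycleW_nonneg _) (mem_univ j)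
      linarith
    have hcge : (m : ℝ) ≤ wcut (cycleBoxPathW m n) A := by
      linarith [sum_wcut_cycleW_nonneg A]
    set i₀ : Fin m := ⟨0, by omega⟩
    obtain ⟨hne, hne'⟩ := hpath i₀
    have hA := eq_univ_product i₀ hcyc
    set S := pathSection A i₀
    have hS : wcut (pathW n) S < 2 := by
      rw [hA, wcut_univ_product] at hcmR
      nlinarith
    have hx : wvol (cycleBoxPathW m n) A = m * (4 * #S - 1) := by
      conv_lhs => rw [hA]
      rw [wvol_univ_product hm, sum_two_add_wdeg_pathW_of_wcut_lt_two hn hne hne' hS]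
    rw [eq_sub_of_add_eq' hVA, hx]
    have hprod : (4 * (#S : ℝ) - 1) * (4 * (n - #S) - 1) ≤ D := by
      have := mul_sub_le_half_mul_half (k := #S) (n := n)
      rw [hD]
      linarith
    have hD0 : 0 ≤ D := by
      have := mul_sq_le_of_lt_two_mul hm hmn
      have h0 : 0 ≤ (m : ℝ) * (2 * n - 1) ^ 2 := by positivity
      exact nonneg_of_mul_nonneg_right (h0.trans this) (by positivity)
    calc (m : ℝ) * (4 * #S - 1) * (2 * m * (2 * n - 1) - m * (4 * #S - 1))
        = m * m * ((4 * (#S : ℝ) - 1) * (4 * (n - #S) - 1)) := by ring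
      _ ≤ m * m * D := by gcongr
      _ ≤ _ := by gcongr
  · push Not at hpath
    obtain ⟨i₀, hi₀⟩ := hpath
    have hcyc : ¬ ∀ j, (cycleSection A j).Nonempty ∧ (cycleSection A j)ᶜ.Nonempty := by
      intro h
      linarith [sum_wcut_cycleW_ge hm h, sum_wcut_pathW_nonneg A]
    obtain ⟨j₀, hj₀⟩ := not_forall.1 hcyc
    refine key (four_mul_wvol_mul_wvol_le hm hn (i₀ := i₀) (j₀ := j₀) (N := m) ?_ hj₀ hcmR ?_
      (by positivity) ?_)
    · rintro ⟨h1, h2⟩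
      simp [hi₀ h1] at h2
    · nlinarith
    · obtain ⟨d, hd0, hd⟩ : ∃ d : ℝ, 0 ≤ d ∧ 2 * m * (2 * n - 1) = 2 * (m : ℝ) ^ 2 + d :=
        ⟨2 * m * (2 * n - 1) - 2 * (m : ℝ) ^ 2, by nlinarith, by ring⟩
      rw [hd]
      have h1 : 0 ≤ (m : ℝ) ^ 3 * (m - 3) := mul_nonneg (by positivity) (by linarith)
      have h2 : 0 ≤ d * (m * (m - 1)) := mul_nonneg hd0 (mul_nonneg (by linarith) (by linarith))
      nlinarith [sq_nonneg d]

lemma mul_wvol_mul_wvol_le_of_two_mul_le (hm : 3 ≤ m) (hn : 2 ≤ n) (hmn : 2 * n ≤ m)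
    (A : Finset (Fin m × Fin n)) :
    n * (wvol (cycleBoxPathW m n) A * wvol (cycleBoxPathW m n) Aᶜ) ≤
      2 * wcut (cycleBoxPathW m n) A * (2 * n - 1) ^ 2 *
        (((m / 2 : ℕ) : ℝ) * (((m + 1) / 2 : ℕ) : ℝ)) := by
  set E : ℝ := ((m / 2 : ℕ) : ℝ) * (((m + 1) / 2 : ℕ) : ℝ) with hE
  have hVA := wvol_add_compl hm hn A
  have hmR : (3 : ℝ) ≤ m := by exact_mod_cast hm
  have hnR : (2 : ℝ) ≤ n := by exact_mod_cast hn
  have hmnR : 2 * (n : ℝ) ≤ m := by exact_mod_cast hmn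
  obtain ⟨c, hc⟩ := wcut_cycleBoxPathW_eq_natCast A
  have key : ∀ K : ℝ, 0 < K → n * (m : ℝ) ^ 2 ≤ 2 * K * E →
      4 * K * (wvol (cycleBoxPathW m n) A * wvol (cycleBoxPathW m n) Aᶜ) ≤
      wcut (cycleBoxPathW m n) A * (2 * m * (2 * n - 1)) ^ 2 →
      n * (wvol (cycleBoxPathW m n) A * wvol (cycleBoxPathW m n) Aᶜ) ≤
      2 * wcut (cycleBoxPathW m n) A * (2 * n - 1) ^ 2 * E := by
    intro K hK hKE h
    refine le_of_mul_le_mul_left ?_ hK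
    rw [hc] at h ⊢
    have h1 := mul_le_mul_of_nonneg_left hKE
      (by positivity : (0 : ℝ) ≤ c * (2 * n - 1) ^ 2)
    have h2 := mul_le_mul_of_nonneg_left h (by positivity : (0 : ℝ) ≤ n)
    linarith
  have hsum := wcut_cycleBoxPathW A
  have hV : 3 * (2 * (n : ℝ)) ^ 2 ≤ 2 * (2 * m * (2 * n - 1)) := by nlinarith
  obtain ⟨q, hq | hq⟩ := Nat.even_or_odd' m
  · have hE' : n * (m : ℝ) ^ 2 ≤ 2 * (2 * n) * E := by
      rw [hE, hq, show 2 * q / 2 = q by omega, show (2 * q + 1) / 2 = q by omega]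
      push_cast
      apply le_of_eq; ring
    refine key (2 * n) (by positivity) hE' ?_
    rcases le_or_gt (2 * (n : ℝ)) (wcut (cycleBoxPathW m n) A) with h | h
    · exact four_mul_mul_le_of_le hVA (by positivity) h
    have hcyc : ¬ ∀ j, (cycleSection A j).Nonempty ∧ (cycleSection A j)ᶜ.Nonempty := by
      intro h'
      linarith [sum_wcut_cycleW_ge hm h', sum_wcut_pathW_nonneg A]
    have hpath : ¬ ∀ i, (pathSection A i).Nonempty ∧ (pathSection A i)ᶜ.Nonempty := by
      intro h'
      linarith [sum_wcut_pathW_ge h', sum_wcut_cycleW_nonneg A]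
    obtain ⟨i₀, hi₀⟩ := not_forall.1 hpath
    obtain ⟨j₀, hj₀⟩ := not_forall.1 hcyc
    refine four_mul_wvol_mul_wvol_le hm hn hi₀ hj₀ h.le hV (by positivity) ?_
    nlinarith [sq_nonneg ((2 * m * (2 * n - 1) : ℝ) - (2 * n) ^ 2)]
  · have hmnR' : 2 * (n : ℝ) + 1 ≤ m := by
      have : 2 * n + 1 ≤ m := by omega
      exact_mod_cast this
    have hE' : n * (m : ℝ) ^ 2 ≤ 2 * (2 * n + 1) * E := by
      have : (m : ℝ) = 2 * q + 1 := by rw [hq]; push_cast; ring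
      rw [hE, show m / 2 = q by omega, show (m + 1) / 2 = q + 1 by omega]
      have hq0 : (n : ℝ) ≤ q := by linarith
      push_cast
      rw [this]
      nlinarith
    rcases Nat.lt_or_ge (2 * n) c with h | h
    · exact key (2 * n + 1) (by positivity) hE'
        (four_mul_mul_le_of_le hVA (by positivity) (by rw [hc]; exact_mod_cast h))
    have hcR : wcut (cycleBoxPathW m n) A ≤ 2 * n := by rw [hc]; exact_mod_cast h
    have hpath : ¬ ∀ i, (pathSection A i).Nonempty ∧ (pathSection A i)ᶜ.Nonempty := by
      intro h'
      linarith [sum_wcut_pathW_ge h', sum_wcut_cycleW_nonneg A]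
    by_cases hcyc : ∀ j, (cycleSection A j).Nonempty ∧ (cycleSection A j)ᶜ.Nonempty
    · have hp := sum_wcut_cycleW_ge hm hcyc
      have hunif : ∀ i, ¬ ((pathSection A i).Nonempty ∧ (pathSection A i)ᶜ.Nonempty) := by
        intro i hi
        have h1 := one_le_wcut_pathW hi.1 hi.2
        have h2 := Finset.single_le_sum (f := fun i => wcut (pathW n) (pathSection A i))
          (fun i _ => wcut_nonneg pathW_nonneg _) (mem_univ i)
        linarith
      have hcge : 2 * (n : ℝ) ≤ wcut (cycleBoxPathW m n) A := by
        linarith [sum_wcut_pathW_nonneg A]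
      have hA := eq_product_univ ⟨0, by omega⟩ hunif
      set T := cycleSection A ⟨0, by omega⟩
      have hx : wvol (cycleBoxPathW m n) A = #T * (4 * n - 2) := by
        conv_lhs => rw [hA]
        rw [wvol_product_univ hm hn]
      rw [eq_sub_of_add_eq' hVA, hx]
      have hprod : (#T : ℝ) * (m - #T) ≤ E := mul_sub_le_half_mul_half
      have hE0 : 0 ≤ E := by positivity
      calc (n : ℝ) * (#T * (4 * n - 2) * (2 * m * (2 * n - 1) - #T * (4 * n - 2)))
          = 2 * (2 * n) * (2 * n - 1) ^ 2 * (#T * (m - #T)) := by ring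
        _ ≤ 2 * (2 * n) * (2 * n - 1) ^ 2 * E := by gcongr
        _ ≤ _ := by gcongr
    · obtain ⟨i₀, hi₀⟩ := not_forall.1 hpath
      obtain ⟨j₀, hj₀⟩ := not_forall.1 hcyc
      refine key (2 * n + 1) (by positivity) hE'
        (four_mul_wvol_mul_wvol_le hm hn hi₀ hj₀ hcR hV (by positivity) ?_)
      generalize hN : 2 * (n : ℝ) = N at *
      have hN4 : 4 ≤ N := by linarith
      obtain ⟨d, hd0, hd⟩ : ∃ d : ℝ, 0 ≤ d ∧ 2 * m * (N - 1) = 2 * (N + 1) * (N - 1) + d :=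
        ⟨2 * m * (N - 1) - 2 * (N + 1) * (N - 1), by nlinarith, by ring⟩
      rw [hd]
      have h1 : 0 ≤ (N + 1) * (N ^ 2 * (N - 4) + 4) := by
        have : 0 ≤ N ^ 2 * (N - 4) := mul_nonneg (by positivity) (by linarith)
        exact mul_nonneg (by linarith) (by linarith)
      have h2 : 0 ≤ d * ((N + 1) * (N - 2)) :=
        mul_nonneg hd0 (mul_nonneg (by linarith) (by linarith))
      nlinarith [sq_nonneg d]

end LowerBound

/-! ### Optimal cuts -/

lemma wcut_pathW_initial {n k : ℕ} (hk : 0 < k) (hkn : k < n) :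
    wcut (pathW n) (univ.filter fun j : Fin n => j.val < k) = 1 := by
  rw [wcut_eq_sum_product, Finset.sum_eq_single (⟨k - 1, by omega⟩, ⟨k, hkn⟩)]
  · simp only [pathW, Matrix.of_apply]
    rw [if_pos (by omega)]
  · rintro ⟨a, b⟩ hab hne
    simp only [mem_product, mem_filter, mem_univ, true_and, mem_compl] at hab
    simp only [ne_eq, Prod.mk.injEq, Fin.ext_iff] at hne
    simp only [pathW, Matrix.of_apply]
    rw [if_neg (by omega)]
  · intro h
    exact absurd (by simp; omega) h

lemma wcut_cycleW_initial {m k : ℕ} (hk : 0 < k) (hkm : k + 1 < m) :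
    wcut (cycleW m) (univ.filter fun i : Fin m => i.val < k) = 2 := by
  set e : Fin m × Fin m := (⟨k - 1, by omega⟩, ⟨k, by omega⟩) with he
  set e' : Fin m × Fin m := (⟨0, by omega⟩, ⟨m - 1, by omega⟩) with he'
  have hne : e ≠ e' := by
    simp only [he, he', ne_eq, Prod.mk.injEq, Fin.ext_iff]; omega
  rw [wcut_eq_sum_product, ← Finset.sum_subset (s₁ := {e, e'})]
  · rw [Finset.sum_pair hne]
    simp only [cycleW, Matrix.of_apply, he, he', ne_eq, Fin.ext_iff]
    rw [if_pos, if_pos]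
    · norm_num
    · rw [succ_mod_eq (by omega), succ_mod_eq (by omega)]
      split_ifs <;> omega
    · rw [succ_mod_eq (by omega), succ_mod_eq (by omega)]
      split_ifs <;> omega
  · intro x hx
    simp only [mem_insert, mem_singleton] at hx
    rcases hx with rfl | rfl <;> simp [he, he'] <;> omega
  · rintro ⟨a, b⟩ hab hne'
    simp only [mem_product, mem_filter, mem_univ, true_and, mem_compl] at hab
    simp only [mem_insert, mem_singleton, he, he', Prod.mk.injEq, Fin.ext_iff, not_or] at hne'
    simp only [cycleW, Matrix.of_apply]
    rw [succ_mod_eq a.2, succ_mod_eq b.2, if_neg]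
    have := a.2
    have := b.2
    split_ifs <;> omega

lemma card_filter_val_lt {n k : ℕ} (hkn : k ≤ n) :
    #(univ.filter fun j : Fin n => j.val < k) = k := by
  rw [Fin.card_filter_val_lt]; omega

lemma wmcut_eq_of_forall_le {V : Type} [Fintype V] [DecidableEq V] {W : Matrix V V ℝ} {M : ℝ}
    (h : ∃ A : Finset V, A.Nonempty ∧ Aᶜ.Nonempty ∧ M = wncut W A)
    (h' : ∀ A : Finset V, A.Nonempty → Aᶜ.Nonempty → M ≤ wncut W A) : wmcut W = M :=
  IsLeast.csInf_eq ⟨h, by rintro x ⟨A, hA, hA', rfl⟩; exact h' A hA hA'⟩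

lemma wncut_cycleBoxPathW_eq {m n : ℕ} (hm : 3 ≤ m) (hn : 2 ≤ n) {A : Finset (Fin m × Fin n)}
    (h : A.Nonempty) (h' : Aᶜ.Nonempty) :
    wncut (cycleBoxPathW m n) A = wcut (cycleBoxPathW m n) A * (2 * m * (2 * n - 1)) /
      (wvol (cycleBoxPathW m n) A * wvol (cycleBoxPathW m n) Aᶜ) := by
  rw [wncut_eq (wvol_cycleBoxPathW_pos hm hn h) (wvol_cycleBoxPathW_pos hm hn h'),
    wvol_univ hm hn]

/-- For `C_m □ P_n` with `m ≥ 3`, `n ≥ 2`: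
if `2n > m` then `Mcut = 2(2n−1)/(16⌊n/2⌋⌈n/2⌉ − 4n + 1)`, and
if `2n ≤ m` then `Mcut = nm/((2n−1)⌊m/2⌋⌈m/2⌉)`. -/
theorem mcut_cycleBoxPath (m n : ℕ) (hm : 3 ≤ m) (hn : 2 ≤ n) :
    (2 * n > m → wmcut (cycleBoxPathW m n) =
      2 * (2 * (n : ℝ) - 1) /
        (16 * ((n / 2 : ℕ) : ℝ) * (((n + 1) / 2 : ℕ) : ℝ) - 4 * (n : ℝ) + 1)) ∧
    (2 * n ≤ m → wmcut (cycleBoxPathW m n) =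
      (n : ℝ) * (m : ℝ) /
        ((2 * (n : ℝ) - 1) * ((m / 2 : ℕ) : ℝ) * (((m + 1) / 2 : ℕ) : ℝ))) := by
  have hnR : (2 : ℝ) ≤ n := by exact_mod_cast hn
  have hmR : (3 : ℝ) ≤ m := by exact_mod_cast hm
  constructor
  · intro hmn
    have hkl : ((n / 2 : ℕ) : ℝ) + (((n + 1) / 2 : ℕ) : ℝ) = n := by
      rw [← Nat.cast_add]; congr 1; omega
    have hk1 : (1 : ℝ) ≤ ((n / 2 : ℕ) : ℝ) := by
      have : 1 ≤ n / 2 := by omega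
      exact_mod_cast this
    have hl1 : (1 : ℝ) ≤ (((n + 1) / 2 : ℕ) : ℝ) := by
      have : 1 ≤ (n + 1) / 2 := by omega
      exact_mod_cast this
    have hD : 0 < 16 * ((n / 2 : ℕ) : ℝ) * (((n + 1) / 2 : ℕ) : ℝ) - 4 * (n : ℝ) + 1 := by
      rw [← hkl]; nlinarith
    refine wmcut_eq_of_forall_le ?_ fun A hA hA' => ?_
    · set S := univ.filter fun j : Fin n => j.val < n / 2 with hS
      have hne : S.Nonempty := ⟨⟨0, by omega⟩, by simp [hS]; omega⟩
      have hne' : Sᶜ.Nonempty := ⟨⟨n - 1, by omega⟩, by simp [hS]; omega⟩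
      have hcut : wcut (pathW n) S = 1 := wcut_pathW_initial (by omega) (by omega)
      have hA : ((univ : Finset (Fin m)) ×ˢ S).Nonempty :=
        Finset.Nonempty.product ⟨⟨0, by omega⟩, mem_univ _⟩ hne
      have hA' : ((univ : Finset (Fin m)) ×ˢ S)ᶜ.Nonempty := by
        obtain ⟨b, hb⟩ := hne'
        exact ⟨(⟨0, by omega⟩, b), by simpa using hb⟩
      have hx : wvol (cycleBoxPathW m n) (univ ×ˢ S) = m * (4 * ((n / 2 : ℕ) : ℝ) - 1) := by
        rw [wvol_univ_product hm, sum_two_add_wdeg_pathW_of_wcut_lt_two hn hne hne'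
          (by rw [hcut]; norm_num), hS, card_filter_val_lt (by omega)]
      refine ⟨univ ×ˢ S, hA, hA', ?_⟩
      rw [wncut_cycleBoxPathW_eq hm hn hA hA', wcut_univ_product, hcut,
        eq_sub_of_add_eq' (wvol_add_compl hm hn _), hx,
        show (m : ℝ) * (4 * ((n / 2 : ℕ) : ℝ) - 1) *
          (2 * m * (2 * n - 1) - m * (4 * ((n / 2 : ℕ) : ℝ) - 1)) = m * m *
          (16 * ((n / 2 : ℕ) : ℝ) * (((n + 1) / 2 : ℕ) : ℝ) - 4 * (n : ℝ) + 1) by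
            rw [← hkl]; ring,
        div_eq_div_iff hD.ne' (by positivity)]
      ring
    · rw [wncut_cycleBoxPathW_eq hm hn hA hA', div_le_div_iff₀ hD
        (mul_pos (wvol_cycleBoxPathW_pos hm hn hA) (wvol_cycleBoxPathW_pos hm hn hA'))]
      have h := mul_le_mul_of_nonneg_left (wvol_mul_wvol_le_of_lt_two_mul hm hn hmn A)
        (by linarith : (0 : ℝ) ≤ 2 * (2 * n - 1))
      linarith
  · intro hmn
    have hkl : ((m / 2 : ℕ) : ℝ) + (((m + 1) / 2 : ℕ) : ℝ) = m := by
      rw [← Nat.cast_add]; congr 1; omega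
    have hk1 : (1 : ℝ) ≤ ((m / 2 : ℕ) : ℝ) := by
      have : 1 ≤ m / 2 := by omega
      exact_mod_cast this
    have hl1 : (1 : ℝ) ≤ (((m + 1) / 2 : ℕ) : ℝ) := by
      have : 1 ≤ (m + 1) / 2 := by omega
      exact_mod_cast this
    have h2n : 0 < 2 * (n : ℝ) - 1 := by linarith
    have hD : 0 < (2 * (n : ℝ) - 1) * ((m / 2 : ℕ) : ℝ) * (((m + 1) / 2 : ℕ) : ℝ) := by
      positivity
    refine wmcut_eq_of_forall_le ?_ fun A hA hA' => ?_
    · set T := univ.filter fun i : Fin m => i.val < m / 2 with hT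
      have hcut : wcut (cycleW m) T = 2 := wcut_cycleW_initial (by omega) (by omega)
      have hA : (T ×ˢ (univ : Finset (Fin n))).Nonempty :=
        ⟨(⟨0, by omega⟩, ⟨0, by omega⟩), by simp [hT]; omega⟩
      have hA' : (T ×ˢ (univ : Finset (Fin n)))ᶜ.Nonempty :=
        ⟨(⟨m - 1, by omega⟩, ⟨0, by omega⟩), by simp [hT]; omega⟩
      have hx : wvol (cycleBoxPathW m n) (T ×ˢ univ) = ((m / 2 : ℕ) : ℝ) * (4 * n - 2) := by
        rw [wvol_product_univ hm hn, hT, card_filter_val_lt (by omega)]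
      refine ⟨T ×ˢ univ, hA, hA', ?_⟩
      rw [wncut_cycleBoxPathW_eq hm hn hA hA', wcut_product_univ, hcut,
        eq_sub_of_add_eq' (wvol_add_compl hm hn _), hx,
        show ((m / 2 : ℕ) : ℝ) * (4 * n - 2) *
          (2 * m * (2 * n - 1) - ((m / 2 : ℕ) : ℝ) * (4 * n - 2)) = 4 * (2 * n - 1) *
          ((2 * (n : ℝ) - 1) * ((m / 2 : ℕ) : ℝ) * (((m + 1) / 2 : ℕ) : ℝ)) by
            rw [← hkl]; ring,
        div_eq_div_iff hD.ne' (by positivity)]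
      ring
    · rw [wncut_cycleBoxPathW_eq hm hn hA hA', div_le_div_iff₀ hD
        (mul_pos (wvol_cycleBoxPathW_pos hm hn hA) (wvol_cycleBoxPathW_pos hm hn hA'))]
      have h := mul_le_mul_of_nonneg_left (mul_wvol_mul_wvol_le_of_two_mul_le hm hn hmn A)
        (by positivity : (0 : ℝ) ≤ m)
      linarith
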